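/- Let h₁,…,hₘ ∈ A = ℂ[x₁,…,xₙ] be a regular sequence, let I = (h₁,…,hₘ), and let {-,-} be a Poisson bracket on O = A/I. Then there exists a ℂ-bilinear map B : A × A → A which is antisymmetric and a derivation in each argument, such that [B(F,G)] = {[F],[G]} for all F, G ∈ A, and B(F,hⱼ) ∈ I for all F ∈ A and all 1 ≤ j ≤ m. -/

import Mathlib

open MvPolynomial

/-- A Poisson bracket on a commutative `ℂ`-algebra `R`: a `ℂ`-bilinear map which is
antisymmetric, a derivation in each argument, and satisfies the Jacobi identity. -/
def IsPoissonBracket {R : Type*} [CommRing R] [Algebra ℂ R] (br : R → R → R) : Prop :=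
  (∀ (c : ℂ) (f g k : R), br (c • f + g) k = c • br f k + br g k) ∧
  (∀ (c : ℂ) (f g k : R), br f (c • g + k) = c • br f g + br f k) ∧
  (∀ f g : R, br f g = - br g f) ∧
  (∀ f g k : R, br f (g * k) = br f g * k + g * br f k) ∧
  (∀ f g k : R, br (f * g) k = br f k * g + f * br g k) ∧
  (∀ f g k : R, br f (br g k) + br g (br k f) + br k (br f g) = 0)

/-- A derivation on a polynomial ring in finitely many variables is determined by the partial
derivatives and its values on the variables. -/
theorem derivation_eq_sum_pderiv {σ R M : Type*} [Fintype σ] [CommRing R] [AddCommGroup M]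
    [Module R M] [Module (MvPolynomial σ R) M] (D : Derivation R (MvPolynomial σ R) M)
    (F : MvPolynomial σ R) : D F = ∑ i, pderiv i F • D (X i) := by
  classical
  induction F using MvPolynomial.induction_on with
  | C a => simp
  | add p q hp hq => simp [hp, hq, add_smul, Finset.sum_add_distrib]
  | mul_X p k hp =>
    simp only [Derivation.leibniz, hp, pderiv_X, Pi.single_apply, smul_eq_mul, add_smul,
      Finset.sum_add_distrib, mul_smul, Finset.smul_sum]
    simp

/-- The biderivation of a polynomial ring with matrix of coefficients `P`. -/
noncomputable def biderivationOfMatrix {σ R : Type*} [Fintype σ] [CommRing R]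
    (P : σ → σ → MvPolynomial σ R) (F G : MvPolynomial σ R) : MvPolynomial σ R :=
  ∑ i, pderiv i F * ∑ j, pderiv j G * P i j

section biderivationOfMatrix

variable {σ R : Type*} [Fintype σ] [CommRing R] {P : σ → σ → MvPolynomial σ R}

theorem biderivationOfMatrix_smul_add_left (c : R) (F G K : MvPolynomial σ R) :
    biderivationOfMatrix P (c • F + G) K =
      c • biderivationOfMatrix P F K + biderivationOfMatrix P G K := by
  simp [biderivationOfMatrix, add_mul, Finset.sum_add_distrib, Finset.smul_sum]

theorem biderivationOfMatrix_mul_left (F G K : MvPolynomial σ R) :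
    biderivationOfMatrix P (F * G) K =
      biderivationOfMatrix P F K * G + F * biderivationOfMatrix P G K := by
  simp only [biderivationOfMatrix, Derivation.leibniz, smul_eq_mul, Finset.sum_mul (ι := σ) _ _ G,
    Finset.mul_sum (ι := σ) _ _ F, ← Finset.sum_add_distrib]
  exact Finset.sum_congr rfl fun i _ => by ring

theorem biderivationOfMatrix_antisymm (hP : ∀ i j, P i j = -P j i) (F G : MvPolynomial σ R) :
    biderivationOfMatrix P F G = -biderivationOfMatrix P G F := by
  simp only [biderivationOfMatrix, Finset.mul_sum, ← Finset.sum_neg_distrib]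
  rw [Finset.sum_comm]
  refine Finset.sum_congr rfl fun i _ => Finset.sum_congr rfl fun j _ => ?_
  rw [hP j i]
  ring

end biderivationOfMatrix

/-- A Poisson bracket on a quotient of a polynomial ring, with second argument fixed, as a
derivation on the polynomial ring. -/
noncomputable def IsPoissonBracket.derivation {σ : Type*} {I : Ideal (MvPolynomial σ ℂ)}
    {br : (MvPolynomial σ ℂ ⧸ I) → (MvPolynomial σ ℂ ⧸ I) → (MvPolynomial σ ℂ ⧸ I)}
    (hbr : IsPoissonBracket br) (g : MvPolynomial σ ℂ ⧸ I) :
    Derivation ℂ (MvPolynomial σ ℂ) (MvPolynomial σ ℂ ⧸ I) :=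
  Derivation.mk'
    ((IsLinearMap.mk' (fun f => br f g)
      { map_add := fun x y => by simpa using hbr.1 1 x y g
        map_smul := fun c x => by
          have h0 : br 0 g = 0 := by simpa using hbr.1 1 0 0 g
          simpa [h0] using hbr.1 c x 0 g }).comp (Ideal.Quotient.mkₐ ℂ I).toLinearMap)
    fun a b => by
      have key := hbr.2.2.2.2.1 (Ideal.Quotient.mk I a) (Ideal.Quotient.mk I b) g
      change br (Ideal.Quotient.mk I (a * b)) g =
        Ideal.Quotient.mk I a * br (Ideal.Quotient.mk I b) g +
          Ideal.Quotient.mk I b * br (Ideal.Quotient.mk I a) g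
      rw [map_mul, key]
      ring

/-- A Poisson bracket on a quotient of a polynomial ring in finitely many variables, in terms of
the partial derivatives of representatives. -/
theorem IsPoissonBracket.mk_mk_eq_sum {σ : Type*} [Fintype σ] {I : Ideal (MvPolynomial σ ℂ)}
    {br : (MvPolynomial σ ℂ ⧸ I) → (MvPolynomial σ ℂ ⧸ I) → (MvPolynomial σ ℂ ⧸ I)}
    (hbr : IsPoissonBracket br) (F G : MvPolynomial σ ℂ) :
    br (Ideal.Quotient.mk I F) (Ideal.Quotient.mk I G) =
      ∑ i, Ideal.Quotient.mk I (pderiv i F) * ∑ j, Ideal.Quotient.mk I (pderiv j G) *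
        br (Ideal.Quotient.mk I (X i)) (Ideal.Quotient.mk I (X j)) := by
  have expand (F : MvPolynomial σ ℂ) (g) : br (Ideal.Quotient.mk I F) g =
      ∑ i, Ideal.Quotient.mk I (pderiv i F) * br (Ideal.Quotient.mk I (X i)) g :=
    derivation_eq_sum_pderiv (hbr.derivation g) F
  rw [expand]
  refine Finset.sum_congr rfl fun i _ => ?_
  rw [hbr.2.2.1, expand, ← Finset.sum_neg_distrib]
  congr 1
  refine Finset.sum_congr rfl fun j _ => ?_
  rw [hbr.2.2.1 (Ideal.Quotient.mk I (X i))]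
  ring

/-- A Poisson bracket on a quotient of a polynomial ring in finitely many variables is induced by
an antisymmetric matrix of polynomials. -/
theorem IsPoissonBracket.exists_antisymm_matrix {σ : Type*} [Fintype σ]
    {I : Ideal (MvPolynomial σ ℂ)}
    {br : (MvPolynomial σ ℂ ⧸ I) → (MvPolynomial σ ℂ ⧸ I) → (MvPolynomial σ ℂ ⧸ I)}
    (hbr : IsPoissonBracket br) :
    ∃ P : σ → σ → MvPolynomial σ ℂ, (∀ i j, P i j = -P j i) ∧
      ∀ F G, Ideal.Quotient.mk I (biderivationOfMatrix P F G) =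
        br (Ideal.Quotient.mk I F) (Ideal.Quotient.mk I G) := by
  obtain ⟨s, hs⟩ := (Ideal.Quotient.mk_surjective (I := I)).hasRightInverse
  let b (i j : σ) := br (Ideal.Quotient.mk I (X i)) (Ideal.Quotient.mk I (X j))
  let P (i j : σ) : MvPolynomial σ ℂ := C (1 / 2) * (s (b i j) - s (b j i))
  have mk_P (i j) : Ideal.Quotient.mk I (P i j) = b i j := by
    have hb : b j i = -b i j := hbr.2.2.1 _ _
    have half : (C (1 / 2) : MvPolynomial σ ℂ) * 2 = 1 := by
      rw [← map_ofNat C 2, ← C_mul]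
      norm_num
    have mk_half := congrArg (Ideal.Quotient.mk I) half
    simp only [map_mul, map_ofNat, map_one] at mk_half
    simp only [P, map_mul, map_sub, hs _, hb]
    linear_combination b i j * mk_half
  refine ⟨P, fun i j => by simp only [P]; ring, fun F G => ?_⟩
  simp only [hbr.mk_mk_eq_sum F G, biderivationOfMatrix, map_sum, map_mul, mk_P, b]

theorem poisson_bracket_lifts_to_biderivation
    (n m : ℕ) (h : Fin m → MvPolynomial (Fin n) ℂ)
    -- `h₁, …, hₘ` is a regular sequence
    (hreg : RingTheory.Sequence.IsRegular (MvPolynomial (Fin n) ℂ) (List.ofFn h))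
    (br : (MvPolynomial (Fin n) ℂ ⧸ Ideal.span (Set.range h)) →
      (MvPolynomial (Fin n) ℂ ⧸ Ideal.span (Set.range h)) →
      (MvPolynomial (Fin n) ℂ ⧸ Ideal.span (Set.range h)))
    (hbr : IsPoissonBracket br) :
    ∃ B : MvPolynomial (Fin n) ℂ → MvPolynomial (Fin n) ℂ → MvPolynomial (Fin n) ℂ,
      -- `B` is `ℂ`-bilinear
      (∀ (c : ℂ) (F G K : MvPolynomial (Fin n) ℂ),
        B (c • F + G) K = c • B F K + B G K) ∧
      (∀ (c : ℂ) (F G K : MvPolynomial (Fin n) ℂ),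
        B F (c • G + K) = c • B F G + B F K) ∧
      -- `B` is antisymmetric
      (∀ F G : MvPolynomial (Fin n) ℂ, B F G = - B G F) ∧
      -- `B` is a derivation in each argument
      (∀ F G K : MvPolynomial (Fin n) ℂ, B F (G * K) = B F G * K + G * B F K) ∧
      (∀ F G K : MvPolynomial (Fin n) ℂ, B (F * G) K = B F K * G + F * B G K) ∧
      -- `B` lifts the Poisson bracket of `O = A / I`
      (∀ F G : MvPolynomial (Fin n) ℂ,
        Ideal.Quotient.mk (Ideal.span (Set.range h)) (B F G) =
          br (Ideal.Quotient.mk (Ideal.span (Set.range h)) F)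
            (Ideal.Quotient.mk (Ideal.span (Set.range h)) G)) ∧
      -- `B(F, hⱼ) ∈ I` for every `F` and `j`
      (∀ (F : MvPolynomial (Fin n) ℂ) (j : Fin m),
        B F (h j) ∈ Ideal.span (Set.range h)) := by
  obtain ⟨P, hP, mk_B⟩ := hbr.exists_antisymm_matrix
  have br_zero (f) : br f 0 = 0 := by simpa using hbr.2.1 1 f 0 0
  have antisymm := biderivationOfMatrix_antisymm hP
  refine ⟨biderivationOfMatrix P, biderivationOfMatrix_smul_add_left, fun c F G K => ?_, antisymm,
    fun F G K => ?_, biderivationOfMatrix_mul_left, mk_B, fun F j => ?_⟩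
  · rw [antisymm, biderivationOfMatrix_smul_add_left, antisymm G F, antisymm K F, smul_neg]
    abel
  · rw [antisymm, biderivationOfMatrix_mul_left, antisymm G F, antisymm K F]
    ring
  · rw [← Ideal.Quotient.eq_zero_iff_mem, mk_B,
      Ideal.Quotient.eq_zero_iff_mem.mpr (Ideal.subset_span (Set.mem_range_self j)), br_zero]
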